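/- Let k be an infinite field and let d = 2s be even with d ≥ 2. For general forms f₁, f₂, f₃ of degree d in R = k[x,y], setting I = (f₁, f₂, f₃), the residue classes of the monomials y^{3s−2} and x·y^{3s−3} form a k-basis of the two-dimensional vector space (R/I)_{3s−2}. -/

import Mathlib

open MvPolynomial

noncomputable section

/-- The binary form of degree `d` in `k[x,y]` with coefficient vector `c`
(`x := X 0`, `y := X 1`). -/
def formOf {k : Type*} [Field k] (d : ℕ) (c : Fin (d + 1) → k) :
    MvPolynomial (Fin 2) k :=
  ∑ l : Fin (d + 1), C (c l) * X 0 ^ (l : ℕ) * X 1 ^ (d - (l : ℕ))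

/-- The degree-`j` graded piece of `R/I`, `R = k[x,y]`: the image of the homogeneous
polynomials of degree `j` in the quotient, as a `k`-vector space. -/
def quotPiece {k : Type*} [Field k] (I : Ideal (MvPolynomial (Fin 2) k)) (j : ℕ) :
    Submodule k (MvPolynomial (Fin 2) k ⧸ I) :=
  Submodule.map (Ideal.Quotient.mkₐ k I).toLinearMap (homogeneousSubmodule (Fin 2) k j)

section BinaryForms

variable {k : Type*} [Field k]

/-- The exponent vector of `x^u y^v`. -/
def binaryExponent (u v : ℕ) : Fin 2 →₀ ℕ := Finsupp.single 0 u + Finsupp.single 1 v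

lemma binaryExponent_inj {u v p q : ℕ} :
    binaryExponent u v = binaryExponent p q ↔ u = p ∧ v = q := by
  constructor
  · intro h
    have h0 := DFunLike.congr_fun h 0
    have h1 := DFunLike.congr_fun h 1
    simp [binaryExponent] at h0 h1
    exact ⟨h0, h1⟩
  · rintro ⟨rfl, rfl⟩
    rfl

lemma eq_binaryExponent (m : Fin 2 →₀ ℕ) : m = binaryExponent (m 0) (m 1) := by
  ext i
  fin_cases i <;> simp [binaryExponent]

lemma X_pow_mul_X_pow_eq_monomial (u v : ℕ) :
    (X 0 ^ u * X 1 ^ v : MvPolynomial (Fin 2) k) = monomial (binaryExponent u v) 1 := by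
  simp [binaryExponent, X_pow_eq_monomial, monomial_mul]

lemma coeff_X_pow_mul_X_pow (u v p q : ℕ) :
    coeff (binaryExponent p q) (X 0 ^ u * X 1 ^ v : MvPolynomial (Fin 2) k) =
      if u = p ∧ v = q then 1 else 0 := by
  rw [X_pow_mul_X_pow_eq_monomial, coeff_monomial]
  simp only [binaryExponent_inj]

lemma isHomogeneous_X_pow_mul_X_pow (u v : ℕ) :
    (X 0 ^ u * X 1 ^ v : MvPolynomial (Fin 2) k).IsHomogeneous (u + v) :=
  (isHomogeneous_X_pow 0 u).mul (isHomogeneous_X_pow 1 v)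

lemma isHomogeneous_formOf (d : ℕ) (c : Fin (d + 1) → k) : (formOf d c).IsHomogeneous d := by
  refine IsHomogeneous.sum _ _ _ fun l _ => ?_
  have h := (isHomogeneous_C (Fin 2) (c l)).mul
    (isHomogeneous_X_pow_mul_X_pow (k := k) (l : ℕ) (d - l))
  rwa [← mul_assoc, show 0 + ((l : ℕ) + (d - l)) = d by omega] at h

/-- Two binary forms of degree `n` agree once their coefficients at `x^u y^v`, `u + v = n`, do. -/
lemma eq_of_coeff_binaryExponent {n : ℕ} {p q : MvPolynomial (Fin 2) k}
    (hp : p.IsHomogeneous n) (hq : q.IsHomogeneous n)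
    (h : ∀ u v, u + v = n → coeff (binaryExponent u v) p = coeff (binaryExponent u v) q) :
    p = q := by
  ext m
  by_cases hm : m.degree = n
  · rw [eq_binaryExponent m]
    exact h _ _ (by simpa [Finsupp.degree_eq_sum] using hm)
  · rw [hp.coeff_eq_zero hm, hq.coeff_eq_zero hm]

lemma coeff_X_pow_mul_X_pow_mul_formOf (d : ℕ) (c : Fin (d + 1) → k) {a b p q : ℕ}
    (h : p + q = a + b + d) :
    coeff (binaryExponent p q) (X 0 ^ a * X 1 ^ b * formOf d c) =
      ∑ l : Fin (d + 1), if (l : ℕ) + a = p then c l else 0 := by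
  rw [formOf, Finset.mul_sum, coeff_sum]
  refine Finset.sum_congr rfl fun l _ => ?_
  rw [show (X 0 ^ a * X 1 ^ b * (C (c l) * X 0 ^ (l : ℕ) * X 1 ^ (d - l)) :
      MvPolynomial (Fin 2) k) = C (c l) * (X 0 ^ (l + a) * X 1 ^ (d - l + b)) by ring,
    coeff_C_mul, coeff_X_pow_mul_X_pow]
  have : ((l : ℕ) + a = p ∧ d - l + b = q) ↔ (l : ℕ) + a = p := by omega
  simp only [this, mul_ite, mul_one, mul_zero]

/-- Multiplying a form `f` of degree `d` by an arbitrary polynomial and taking the component of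
degree `d + n` gives a combination of the `x^a y^(n-a) f`; the index `t = n + 1` also allows for
the empty range of multipliers. -/
lemma homogeneousComponent_mul_mem_span {d j t : ℕ} (hj : d + t = j + 1)
    {f : MvPolynomial (Fin 2) k} (hf : f.IsHomogeneous d) (g : MvPolynomial (Fin 2) k) :
    homogeneousComponent j (g * f) ∈
      Submodule.span k (Set.range fun a : Fin t => X 0 ^ (a : ℕ) * X 1 ^ (t - 1 - a) * f) := by
  induction g using MvPolynomial.induction_on' with
  | monomial m r =>
    have e : monomial m r * f = r • (X 0 ^ m 0 * X 1 ^ m 1 * f) := by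
      rw [X_pow_mul_X_pow_eq_monomial, ← eq_binaryExponent, ← smul_mul_assoc, smul_monomial]
      simp
    rw [e, map_smul]
    refine Submodule.smul_mem _ _ ?_
    rw [homogeneousComponent_of_mem ((isHomogeneous_X_pow_mul_X_pow (m 0) (m 1)).mul hf)]
    split_ifs with h
    · refine Submodule.subset_span ⟨⟨m 0, by omega⟩, ?_⟩
      simp only [show t - 1 - m 0 = m 1 by omega]
    · exact zero_mem _
  | add p q hp hq =>
    rw [add_mul, map_add]
    exact add_mem hp hq

/-- The exponent of `x` in the monomial indexing a column of `formMatrix`. -/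
def formColumn (t : ℕ) (p : Fin 3 × Fin t) : ℕ := 2 + p.2 + t * p.1

lemma formColumn_injective (t : ℕ) : Function.Injective (formColumn t) := by
  intro p q h
  apply finProdFinEquiv.injective
  ext
  simp only [formColumn] at h
  simp only [finProdFinEquiv_apply_val]
  omega

lemma exists_formColumn_eq {t u : ℕ} (h2 : 2 ≤ u) (hu : u < 3 * t + 2) :
    ∃ p, formColumn t p = u := by
  refine ⟨finProdFinEquiv.symm ⟨u - 2, by omega⟩, ?_⟩
  have := congrArg Fin.val (finProdFinEquiv.apply_symm_apply (⟨u - 2, by omega⟩ : Fin (3 * t)))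
  simp only [finProdFinEquiv_apply_val] at this
  simp only [formColumn]
  omega

lemma formColumn_lt (t : ℕ) (p : Fin 3 × Fin t) : formColumn t p < 3 * t + 2 := by
  have := (finProdFinEquiv p).isLt
  simp only [finProdFinEquiv_apply_val] at this
  simp only [formColumn]
  omega

/-- The coefficients of the products `x^a y^(t-1-a) f_i`, `a < t`, of three forms of degree `d`
at the monomials divisible by `x^2`, where `c` lists the coefficients of the forms. -/
def formMatrix {A : Type*} [AddCommMonoid A] (d t : ℕ) (c : Fin 3 × Fin (d + 1) → A) :
    Matrix (Fin 3 × Fin t) (Fin 3 × Fin t) A :=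
  .of fun p q => ∑ l : Fin (d + 1), if (l : ℕ) + p.2 = formColumn t q then c (p.1, l) else 0

lemma eval_det_formMatrix (d t : ℕ) (c : Fin 3 × Fin (d + 1) → k) :
    eval c (formMatrix d t X).det = (formMatrix d t c).det := by
  rw [RingHom.map_det]
  congr 1
  ext p q
  simp [formMatrix, map_sum, apply_ite]

/-- For `x^2 y^(2t)`, `x^(t+2) y^t`, `x^(2t+2)` the coefficient matrix is the identity. -/
lemma exists_formMatrix_eq_one {d t : ℕ} (h : d = 2 * t + 2) :
    ∃ c : Fin 3 × Fin (d + 1) → k, formMatrix d t c = 1 := by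
  refine ⟨fun p => if (p.2 : ℕ) = 2 + t * p.1 then 1 else 0, ?_⟩
  ext p q
  have hp : t * (p.1 : ℕ) ≤ t * 2 := Nat.mul_le_mul_left t (by omega)
  have hc : formColumn t p = 2 + p.2 + t * p.1 := rfl
  rw [Matrix.one_apply, formMatrix, Matrix.of_apply,
    Finset.sum_eq_single (⟨2 + t * p.1, by omega⟩ : Fin (d + 1))]
  · simp only [if_true]
    refine if_congr ?_ rfl rfl
    rw [← (formColumn_injective t).eq_iff, hc]
    omega
  · intro l _ hl
    have : (l : ℕ) ≠ 2 + t * p.1 := fun h => hl (Fin.ext h)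
    simp [this]
  · simp

variable {d t : ℕ} {c : Fin 3 → Fin (d + 1) → k}

/-- The combination of the products `x^a y^(t-1-a) f_i` with coefficient vector `w`. -/
def formCombination (d t : ℕ) (c : Fin 3 → Fin (d + 1) → k) (w : Fin 3 × Fin t → k) :
    MvPolynomial (Fin 2) k :=
  ∑ p, w p • (X 0 ^ (p.2 : ℕ) * X 1 ^ (t - 1 - p.2) * formOf d (c p.1))

lemma formCombination_mem (w : Fin 3 × Fin t → k) :
    formCombination d t c w ∈
      Ideal.span {formOf d (c 0), formOf d (c 1), formOf d (c 2)} := by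
  refine sum_mem fun p _ => Submodule.smul_of_tower_mem _ _ <|
    Ideal.mul_mem_left _ _ (Ideal.subset_span ?_)
  obtain ⟨i, a⟩ := p
  fin_cases i <;> simp

lemma isHomogeneous_formCombination {j : ℕ} (hj : d + t = j + 1) (w : Fin 3 × Fin t → k) :
    (formCombination d t c w).IsHomogeneous j := by
  refine IsHomogeneous.sum _ _ _ fun p _ => ?_
  have h := (isHomogeneous_X_pow_mul_X_pow (k := k) (p.2 : ℕ) (t - 1 - p.2)).mul
    (isHomogeneous_formOf d (c p.1))
  rw [show (p.2 : ℕ) + (t - 1 - p.2) + d = j by omega] at h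
  exact (homogeneousSubmodule (Fin 2) k j).smul_mem _ h

lemma coeff_formCombination {j v : ℕ} (hj : d + t = j + 1) (w : Fin 3 × Fin t → k)
    (q : Fin 3 × Fin t) (hv : formColumn t q + v = j) :
    coeff (binaryExponent (formColumn t q) v) (formCombination d t c w) =
      Matrix.vecMul w (formMatrix d t fun p => c p.1 p.2) q := by
  rw [formCombination, coeff_sum, Matrix.vecMul, dotProduct]
  refine Finset.sum_congr rfl fun p _ => ?_
  rw [coeff_smul, coeff_X_pow_mul_X_pow_mul_formOf _ _ (by omega), smul_eq_mul, formMatrix,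
    Matrix.of_apply]

lemma exists_formCombination_eq {j : ℕ} (hj : d + t = j + 1) {p : MvPolynomial (Fin 2) k}
    (hp : p.IsHomogeneous j)
    (hI : p ∈ Ideal.span {formOf d (c 0), formOf d (c 1), formOf d (c 2)}) :
    ∃ w, p = formCombination d t c w := by
  obtain ⟨g, hg⟩ : ∃ g : Fin 3 → MvPolynomial (Fin 2) k, p = ∑ i, g i * formOf d (c i) := by
    obtain ⟨g₀, z, hz, rfl⟩ := Ideal.mem_span_insert.1 hI
    obtain ⟨g₁, g₂, rfl⟩ := Ideal.mem_span_pair.1 hz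
    exact ⟨![g₀, g₁, g₂], by simp [Fin.sum_univ_three, add_assoc]⟩
  have h i := (Submodule.mem_span_range_iff_exists_fun k).1
    (homogeneousComponent_mul_mem_span hj (isHomogeneous_formOf d (c i)) (g i))
  choose w hw using h
  refine ⟨fun q => w q.1 q.2, ?_⟩
  rw [formCombination, Fintype.sum_prod_type]
  simp only [hw]
  rw [← map_sum, ← hg, homogeneousComponent_of_mem hp, if_pos rfl]

end BinaryForms

/-- For an infinite field `k` and even `d = 2s ≥ 2`, for general forms `f₁, f₂, f₃` of
degree `d` in `R = k[x,y]` (genericity encoded as the nonvanishing locus of a nonzero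
polynomial on the parameter space `k^{3(d+1)}`), with `I = (f₁,f₂,f₃)`, the residue
classes of `y^{3s−2}` and `x·y^{3s−3}` form a `k`-basis of the two-dimensional
vector space `(R/I)_{3s−2}`. -/
theorem general_binary_forms_even_monomials_basis (k : Type*) [Field k] [Infinite k]
    (s d : ℕ) (hs : 1 ≤ s) (hd : d = 2 * s) :
    ∃ P : MvPolynomial (Fin 3 × Fin (d + 1)) k, P ≠ 0 ∧
      ∀ c : Fin 3 → Fin (d + 1) → k,
        eval (fun p => c p.1 p.2) P ≠ 0 →
          LinearIndependent k
            ![Ideal.Quotient.mk (Ideal.span {formOf d (c 0), formOf d (c 1), formOf d (c 2)})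
                (X 1 ^ (3 * s - 2)),
              Ideal.Quotient.mk (Ideal.span {formOf d (c 0), formOf d (c 1), formOf d (c 2)})
                (X 0 * X 1 ^ (3 * s - 3))] ∧
          Submodule.span k
              {Ideal.Quotient.mk (Ideal.span {formOf d (c 0), formOf d (c 1), formOf d (c 2)})
                (X 1 ^ (3 * s - 2)),
               Ideal.Quotient.mk (Ideal.span {formOf d (c 0), formOf d (c 1), formOf d (c 2)})
                (X 0 * X 1 ^ (3 * s - 3))} =
            quotPiece (Ideal.span {formOf d (c 0), formOf d (c 1), formOf d (c 2)})
              (3 * s - 2) ∧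
          Module.finrank k
            (quotPiece (Ideal.span {formOf d (c 0), formOf d (c 1), formOf d (c 2)})
              (3 * s - 2)) = 2 := by
  obtain ⟨t, rfl⟩ : ∃ t, s = t + 1 := ⟨s - 1, by omega⟩
  have hdt : d = 2 * t + 2 := by omega
  rw [show 3 * (t + 1) - 2 = 3 * t + 1 by omega, show 3 * (t + 1) - 3 = 3 * t by omega]
  refine ⟨(formMatrix d t X).det, ?_, fun c hc => ?_⟩
  · obtain ⟨c, hc⟩ := exists_formMatrix_eq_one (k := k) hdt
    intro h
    have := eval_det_formMatrix d t c
    simp [h, hc] at this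
  rw [eval_det_formMatrix] at hc
  have hj : d + t = (3 * t + 1) + 1 := by omega
  set I := Ideal.span {formOf d (c 0), formOf d (c 1), formOf d (c 2)} with hI
  have hy : (X 1 ^ (3 * t + 1) : MvPolynomial (Fin 2) k) = X 0 ^ 0 * X 1 ^ (3 * t + 1) := by simp
  have hxy : (X 0 * X 1 ^ (3 * t) : MvPolynomial (Fin 2) k) = X 0 ^ 1 * X 1 ^ (3 * t) := by simp
  have hhom (a b : k) : (a • X 1 ^ (3 * t + 1) + b • (X 0 * X 1 ^ (3 * t)) :
      MvPolynomial (Fin 2) k).IsHomogeneous (3 * t + 1) := by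
    rw [hy, hxy]
    refine (homogeneousSubmodule (Fin 2) k _).add_mem
      (Submodule.smul_mem _ _ ?_) (Submodule.smul_mem _ _ ?_)
    · simpa using isHomogeneous_X_pow_mul_X_pow (k := k) 0 (3 * t + 1)
    · simpa [add_comm] using isHomogeneous_X_pow_mul_X_pow (k := k) 1 (3 * t)
  have hcoeff (a b : k) (u v : ℕ) (huv : u + v = 3 * t + 1) :
      coeff (binaryExponent u v) (a • X 1 ^ (3 * t + 1) + b • (X 0 * X 1 ^ (3 * t)) :
        MvPolynomial (Fin 2) k) = if u = 0 then a else if u = 1 then b else 0 := by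
    rw [hy, hxy, coeff_add, coeff_smul, coeff_smul, coeff_X_pow_mul_X_pow, coeff_X_pow_mul_X_pow]
    rcases u with _ | _ | u
    · simp [show 3 * t + 1 = v by omega]
    · simp [show 3 * t = v by omega]
    · simp
  have hindep : LinearIndependent k
      ![Ideal.Quotient.mk I (X 1 ^ (3 * t + 1)), Ideal.Quotient.mk I (X 0 * X 1 ^ (3 * t))] := by
    rw [LinearIndependent.pair_iff]
    intro a b hab
    have hmem : a • X 1 ^ (3 * t + 1) + b • (X 0 * X 1 ^ (3 * t)) ∈ I :=
      Ideal.Quotient.eq_zero_iff_mem.1 hab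
    obtain ⟨w, hw⟩ := exists_formCombination_eq hj (hhom a b) hmem
    have hw0 : w = 0 := by
      refine Matrix.eq_zero_of_vecMul_eq_zero hc (funext fun q => ?_)
      have hq := formColumn_lt t q
      have hq2 : 2 ≤ formColumn t q := by simp only [formColumn]; omega
      have hv : formColumn t q + (3 * t + 1 - formColumn t q) = 3 * t + 1 := by omega
      rw [← coeff_formCombination hj w q hv, ← hw, hcoeff _ _ _ _ hv, if_neg (by omega),
        if_neg (by omega), Pi.zero_apply]
    have hz : formCombination d t c w = 0 := by simp [hw0, formCombination]
    rw [hz] at hw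
    have h0 := hcoeff a b 0 (3 * t + 1) (by omega)
    have h1 := hcoeff a b 1 (3 * t) (by omega)
    rw [hw] at h0 h1
    simp at h0 h1
    exact ⟨h0.symm, h1.symm⟩
  have hspan : Submodule.span k
      {Ideal.Quotient.mk I (X 1 ^ (3 * t + 1)), Ideal.Quotient.mk I (X 0 * X 1 ^ (3 * t))} =
        quotPiece I (3 * t + 1) := by
    apply le_antisymm
    · rw [Submodule.span_le, Set.insert_subset_iff, Set.singleton_subset_iff]
      exact ⟨⟨X 1 ^ (3 * t + 1), by simpa using hhom 1 0, rfl⟩,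
        ⟨X 0 * X 1 ^ (3 * t), by simpa using hhom 0 1, rfl⟩⟩
    · rintro _ ⟨p, hp, rfl⟩
      obtain ⟨w, hw⟩ := (Matrix.vecMul_surjective_iff_isUnit.2
        ((Matrix.isUnit_iff_isUnit_det _).2 (isUnit_iff_ne_zero.2 hc)))
        fun q => coeff (binaryExponent (formColumn t q) (3 * t + 1 - formColumn t q)) p
      set r := p - formCombination d t c w with hr
      have hrh : r.IsHomogeneous (3 * t + 1) :=
        (homogeneousSubmodule (Fin 2) k _).sub_mem hp (isHomogeneous_formCombination hj w)
      have hrr : r = coeff (binaryExponent 0 (3 * t + 1)) r • X 1 ^ (3 * t + 1) +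
          coeff (binaryExponent 1 (3 * t)) r • (X 0 * X 1 ^ (3 * t)) := by
        refine eq_of_coeff_binaryExponent hrh (hhom _ _) fun u v huv => ?_
        rw [hcoeff _ _ _ _ huv]
        rcases Nat.lt_or_ge u 2 with hu | hu
        · interval_cases u
          · rw [if_pos rfl, show v = 3 * t + 1 by omega]
          · rw [if_neg one_ne_zero, if_pos rfl, show v = 3 * t by omega]
        · obtain ⟨q, rfl⟩ := exists_formColumn_eq (t := t) hu (by omega)
          rw [if_neg (by omega), if_neg (by omega), hr, coeff_sub, coeff_formCombination hj w q huv]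
          have hwq := congrFun hw q
          beta_reduce at hwq
          rw [hwq, show 3 * t + 1 - formColumn t q = v by omega, sub_self]
      have hpr : Ideal.Quotient.mk I p = Ideal.Quotient.mk I r :=
        Ideal.Quotient.eq.2 (by simpa [hr] using formCombination_mem (t := t) (c := c) w)
      refine Submodule.mem_span_pair.2
        ⟨coeff (binaryExponent 0 (3 * t + 1)) r, coeff (binaryExponent 1 (3 * t)) r, ?_⟩
      exact (congrArg (Ideal.Quotient.mk I) hrr.symm).trans hpr.symm
  refine ⟨hindep, hspan, ?_⟩
  rw [← hspan, ← Matrix.range_cons_cons_empty _ _ ![], finrank_span_eq_card hindep,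
    Fintype.card_fin]
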